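/- Every dagger special symmetric Frobenius algebra in CPM(fHilb) is canonical: if (Δ, E, Δ†, E†) on a finite-dimensional Hilbert space H satisfies coassociativity, counit laws, symmetry, specialness (Δ† ∘ Δ = id) and the Frobenius law as CP maps, then there exist linear maps δ : H → H ⊗ H and ε : H → ℂ forming a dagger special symmetric Frobenius algebra in fHilb with Δ(ρ) = δ ρ δ† and E(ρ) = ε ρ ε† for all ρ. -/

import Mathlib

open Matrix Kronecker BigOperators

/-- Kraus operator of `(Δ ⊗ id) ∘ Δ` from Kraus operators `A, B` of `Δ`. -/
noncomputable def coassocL {h : Type*} [Fintype h] [DecidableEq h]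
    (A B : Matrix (h × h) h ℂ) : Matrix ((h × h) × h) h ℂ :=
  (A ⊗ₖ (1 : Matrix h h ℂ)) * B

/-- Kraus operator of `(id ⊗ Δ) ∘ Δ`, reassociated. -/
noncomputable def coassocR {h : Type*} [Fintype h] [DecidableEq h]
    (A B : Matrix (h × h) h ℂ) : Matrix ((h × h) × h) h ℂ :=
  Matrix.reindex (Equiv.prodAssoc h h h).symm (Equiv.refl h)
    (((1 : Matrix h h ℂ) ⊗ₖ A) * B)

/-- Kraus operator of the Frobenius composite `(Δ† ⊗ id) ∘ (id ⊗ Δ)`. -/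
noncomputable def frobCPL {h : Type*} [Fintype h] [DecidableEq h]
    (A B : Matrix (h × h) h ℂ) : Matrix (h × h) (h × h) ℂ :=
  (Aᴴ ⊗ₖ (1 : Matrix h h ℂ)) *
    Matrix.reindex (Equiv.prodAssoc h h h).symm (Equiv.refl (h × h))
      ((1 : Matrix h h ℂ) ⊗ₖ B)

/-- Kraus operator of the Frobenius composite `(id ⊗ Δ†) ∘ (Δ ⊗ id)`. -/
noncomputable def frobCPR {h : Type*} [Fintype h] [DecidableEq h]
    (A B : Matrix (h × h) h ℂ) : Matrix (h × h) (h × h) ℂ :=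
  ((1 : Matrix h h ℂ) ⊗ₖ Aᴴ) *
    Matrix.reindex (Equiv.prodAssoc h h h) (Equiv.refl (h × h))
      (B ⊗ₖ (1 : Matrix h h ℂ))

section KrausFamilies

variable {ι κ p q : Type*} [Fintype ι] [Fintype q]

theorem eq_zero_of_sum_mul_star_eq_zero {f : ι → ℂ} (hf : ∑ i, f i * star (f i) = 0) (i : ι) :
    f i = 0 := by
  have h1 : ∑ i, ‖f i‖ ^ 2 = 0 := by
    have : ((∑ i, ‖f i‖ ^ 2 : ℝ) : ℂ) = 0 := by
      rw [← hf]
      push_cast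
      exact Finset.sum_congr rfl fun i _ => (Complex.mul_conj' (f i)).symm
    exact_mod_cast this
  have h2 := (Finset.sum_eq_zero_iff_of_nonneg fun i _ => by positivity).1 h1 i (Finset.mem_univ i)
  simpa using h2

theorem exists_phase {f g : κ → ℂ} (hfg : ∀ i j, f i * star (f j) = g i * star (g j)) :
    ∃ ω : ℂ, ∀ i, f i = ω * g i := by
  by_cases hf : ∃ j, f j ≠ 0
  · obtain ⟨j, hj⟩ := hf
    refine ⟨star (g j) / star (f j), fun i => ?_⟩
    have hj' : star (f j) ≠ 0 := star_ne_zero.2 hj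
    have := hfg i j
    field_simp
    linear_combination this
  · push Not at hf
    exact ⟨0, fun i => by simp [hf]⟩

theorem mul_single_mul_conjTranspose_apply [DecidableEq q] (K : Matrix p q ℂ) (a b : q) (x y : p) :
    (K * Matrix.single a b (1 : ℂ) * Kᴴ) x y = K x a * star (K y b) := by
  rw [Matrix.mul_apply]
  simp [Matrix.mul_apply, Matrix.single_apply, ite_and]

/-- Two operators whose doublings agree differ by a phase. -/
theorem exists_phase_of_doubling_eq [DecidableEq q] {A B : Matrix p q ℂ}
    (hAB : ∀ ρ : Matrix q q ℂ, A * ρ * Aᴴ = B * ρ * Bᴴ) : ∃ ω : ℂ, A = ω • B := by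
  obtain ⟨ω, hω⟩ := exists_phase (f := fun i : p × q => A i.1 i.2) (g := fun i => B i.1 i.2)
    fun i j => by
      have := congrFun (congrFun (hAB (Matrix.single i.2 j.2 1)) i.1) j.1
      rwa [mul_single_mul_conjTranspose_apply, mul_single_mul_conjTranspose_apply] at this
  exact ⟨ω, by ext x y; exact hω (x, y)⟩

/-- Every Kraus operator of the identity map is a scalar. -/
theorem exists_scalar_of_kraus_id [DecidableEq q] [Nonempty q] {K : ι → Matrix q q ℂ}
    (hK : ∀ ρ : Matrix q q ℂ, ∑ i, K i * ρ * (K i)ᴴ = ρ) :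
    ∃ s : ι → ℂ, (∀ i, K i = s i • (1 : Matrix q q ℂ)) ∧ ∑ i, s i * star (s i) = 1 := by
  have key (x a y b : q) : ∑ i, K i x a * star (K i y b) = if a = x ∧ b = y then 1 else 0 := by
    have := congrFun (congrFun (hK (Matrix.single a b 1)) x) y
    simpa only [Matrix.sum_apply, mul_single_mul_conjTranspose_apply, Matrix.single_apply] using this
  obtain ⟨x₀⟩ := ‹Nonempty q›
  refine ⟨fun i => K i x₀ x₀, fun i => ?_, by rw [key]; simp⟩
  ext x y
  by_cases hxy : x = y
  · subst hxy
    have : ∑ i, (K i x x - K i x₀ x₀) * star (K i x x - K i x₀ x₀) = 0 := by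
      simp only [star_sub, sub_mul, mul_sub, Finset.sum_sub_distrib, key]
      simp
    simpa [sub_eq_zero] using eq_zero_of_sum_mul_star_eq_zero this i
  · have : ∑ i, K i x y * star (K i x y) = 0 := by
      rw [key, if_neg fun h => hxy h.1.symm]
    simpa [hxy] using eq_zero_of_sum_mul_star_eq_zero this i

theorem sum_smul_doubling (c : ι → ℂ) (hc : ∑ i, c i * star (c i) = 1) (A : Matrix p q ℂ)
    (ρ : Matrix q q ℂ) : ∑ i, (c i • A) * ρ * (c i • A)ᴴ = A * ρ * Aᴴ := by
  simp only [Matrix.conjTranspose_smul, Matrix.smul_mul, Matrix.mul_smul, smul_smul,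
    ← Finset.sum_smul]
  rw [show ∑ i, star (c i) * c i = 1 by rw [← hc]; simp only [mul_comm], one_smul]

end KrausFamilies

section Effects

variable {h : Type*} [DecidableEq h]

/-- The operator `ε ⊗ id`. -/
def effectLeft (ε : h → ℂ) : Matrix h (h × h) ℂ :=
  Matrix.of fun x p => ε p.1 * (1 : Matrix h h ℂ) x p.2

/-- The operator `id ⊗ ε`. -/
def effectRight (ε : h → ℂ) : Matrix h (h × h) ℂ :=
  Matrix.of fun x p => ε p.2 * (1 : Matrix h h ℂ) x p.1

theorem effectLeft_smul (c : ℂ) (ε : h → ℂ) : effectLeft (c • ε) = c • effectLeft ε := by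
  ext; simp [effectLeft, mul_assoc]

theorem effectRight_smul (c : ℂ) (ε : h → ℂ) : effectRight (c • ε) = c • effectRight ε := by
  ext; simp [effectRight, mul_assoc]

variable [Fintype h]

theorem effectLeft_mul_apply {q : Type*} (ε : h → ℂ) (A : Matrix (h × h) q ℂ) (x : h) (y : q) :
    (effectLeft ε * A) x y = ∑ c, ε c * A (c, x) y := by
  simp [effectLeft, Matrix.mul_apply, Fintype.sum_prod_type, Matrix.one_apply]

theorem effectRight_mul_apply {q : Type*} (ε : h → ℂ) (A : Matrix (h × h) q ℂ) (x : h) (y : q) :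
    (effectRight ε * A) x y = ∑ c, ε c * A (x, c) y := by
  simp [effectRight, Matrix.mul_apply, Fintype.sum_prod_type, Matrix.one_apply]

theorem coassocL_apply (A B : Matrix (h × h) h ℂ) (x y z w : h) :
    coassocL A B ((x, y), z) w = ∑ v, A (x, y) v * B (v, z) w := by
  simp [coassocL, Matrix.mul_apply, Fintype.sum_prod_type, Matrix.one_apply]

theorem coassocR_apply (A B : Matrix (h × h) h ℂ) (x y z w : h) :
    coassocR A B ((x, y), z) w = ∑ v, A (y, z) v * B (x, v) w := by
  simp [coassocR, Matrix.mul_apply, Fintype.sum_prod_type, Matrix.one_apply]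

theorem frobCPL_apply (A B : Matrix (h × h) h ℂ) (x y z w : h) :
    frobCPL A B (x, y) (z, w) = ∑ v, star (A (z, v) x) * B (v, y) w := by
  simp [frobCPL, Matrix.mul_apply, Fintype.sum_prod_type, Matrix.one_apply]

theorem frobCPR_apply (A B : Matrix (h × h) h ℂ) (x y z w : h) :
    frobCPR A B (x, y) (z, w) = ∑ v, star (A (v, w) y) * B (x, v) z := by
  simp [frobCPR, Matrix.mul_apply, Fintype.sum_prod_type, Matrix.one_apply]

theorem coassocL_smul (s t : ℂ) (A B : Matrix (h × h) h ℂ) :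
    coassocL (s • A) (t • B) = (s * t) • coassocL A B := by
  ext ⟨⟨x, y⟩, z⟩ w
  simp only [coassocL_apply, Matrix.smul_apply, smul_eq_mul, Finset.mul_sum]
  exact Finset.sum_congr rfl fun _ _ => by ring

theorem coassocR_smul (s t : ℂ) (A B : Matrix (h × h) h ℂ) :
    coassocR (s • A) (t • B) = (s * t) • coassocR A B := by
  ext ⟨⟨x, y⟩, z⟩ w
  simp only [coassocR_apply, Matrix.smul_apply, smul_eq_mul, Finset.mul_sum]
  exact Finset.sum_congr rfl fun _ _ => by ring

theorem frobCPL_smul (s t : ℂ) (A B : Matrix (h × h) h ℂ) :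
    frobCPL (s • A) (t • B) = (star s * t) • frobCPL A B := by
  ext ⟨x, y⟩ ⟨z, w⟩
  simp only [frobCPL_apply, Matrix.smul_apply, smul_eq_mul, Finset.mul_sum, star_mul']
  exact Finset.sum_congr rfl fun _ _ => by ring

theorem frobCPR_smul (s t : ℂ) (A B : Matrix (h × h) h ℂ) :
    frobCPR (s • A) (t • B) = (star s * t) • frobCPR A B := by
  ext ⟨x, y⟩ ⟨z, w⟩
  simp only [frobCPR_apply, Matrix.smul_apply, smul_eq_mul, Finset.mul_sum, star_mul']
  exact Finset.sum_congr rfl fun _ _ => by ring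

/-- The Frobenius form `A ε†`, as a matrix. -/
def frobForm (ε : h → ℂ) (A : Matrix (h × h) h ℂ) : Matrix h h ℂ :=
  Matrix.of fun x y => ∑ w, A (x, y) w * star (ε w)

theorem mul_conjTranspose_effectRight_apply {q : Type*} (η : h → ℂ) (M : Matrix q (h × h) ℂ)
    (x : q) (z : h) : (M * (effectRight η)ᴴ) x z = ∑ w, M x (z, w) * star (η w) := by
  rw [← Matrix.conjTranspose_conjTranspose M, ← Matrix.conjTranspose_mul,
    Matrix.conjTranspose_apply, effectRight_mul_apply]
  simp [mul_comm]

theorem mul_conjTranspose_effectLeft_apply {q : Type*} (η : h → ℂ) (M : Matrix q (h × h) ℂ)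
    (x : q) (z : h) : (M * (effectLeft η)ᴴ) x z = ∑ w, M x (w, z) * star (η w) := by
  rw [← Matrix.conjTranspose_conjTranspose M, ← Matrix.conjTranspose_mul,
    Matrix.conjTranspose_apply, effectLeft_mul_apply]
  simp [mul_comm]

theorem effectLeft_doubling_apply (ε : h → ℂ) (M : Matrix (h × h) (h × h) ℂ) (x y : h) :
    (effectLeft ε * (M * (effectLeft ε)ᴴ)) x y
      = ∑ c, ∑ d, ε c * M (c, x) (d, y) * star (ε d) := by
  simp only [effectLeft_mul_apply, mul_conjTranspose_effectLeft_apply, Finset.mul_sum, mul_assoc]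

theorem effectRight_doubling_apply (ε : h → ℂ) (M : Matrix (h × h) (h × h) ℂ) (x y : h) :
    (effectRight ε * (M * (effectRight ε)ᴴ)) x y
      = ∑ c, ∑ d, ε c * M (x, c) (y, d) * star (ε d) := by
  simp only [effectRight_mul_apply, mul_conjTranspose_effectRight_apply, Finset.mul_sum, mul_assoc]

theorem effect_frobCPL_effect (ε η : h → ℂ) (A B : Matrix (h × h) h ℂ) :
    effectLeft ε * frobCPL A B * (effectRight η)ᴴ
      = ((frobForm ε A).map star * frobForm η B)ᵀ := by
  ext y z
  rw [Matrix.mul_assoc, effectLeft_mul_apply, Matrix.transpose_apply, Matrix.mul_apply]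
  simp only [mul_conjTranspose_effectRight_apply, frobCPL_apply,
    frobForm, Matrix.map_apply, Matrix.of_apply, star_sum, star_mul', star_star,
    Finset.sum_mul, Finset.mul_sum]
  rw [Finset.sum_comm_cycle]
  refine Finset.sum_congr rfl fun v _ => ?_
  rw [Finset.sum_comm]
  exact Finset.sum_congr rfl fun w _ => Finset.sum_congr rfl fun x _ => by ring

theorem effect_frobCPR_effect (ε η : h → ℂ) (A B : Matrix (h × h) h ℂ) :
    effectLeft ε * frobCPR A B * (effectRight η)ᴴ
      = (effectRight η * A)ᴴ * (effectLeft ε * B) := by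
  ext y z
  rw [Matrix.mul_assoc, effectLeft_mul_apply, Matrix.mul_apply]
  simp only [mul_conjTranspose_effectRight_apply, frobCPR_apply, Matrix.conjTranspose_apply,
    effectRight_mul_apply, effectLeft_mul_apply, star_sum, star_mul',
    Finset.sum_mul, Finset.mul_sum]
  rw [Finset.sum_comm_cycle]
  refine Finset.sum_congr rfl fun v _ => ?_
  exact Finset.sum_congr rfl fun w _ => Finset.sum_congr rfl fun x _ => by ring

end Effects

section Purification

variable {h : Type*} [DecidableEq h]

theorem exists_star_mul_self_of_isometry_smul [Nonempty h] {q : Type*} [Fintype q]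
    {A : Matrix q h ℂ} {c : ℂ} (hA : Aᴴ * A = c • (1 : Matrix h h ℂ)) : ∃ κ : ℂ, star κ * κ = c := by
  obtain ⟨x⟩ := ‹Nonempty h›
  have hx : ((∑ p, ‖A p x‖ ^ 2 : ℝ) : ℂ) = c := by
    have := congrFun (congrFun hA x) x
    simp only [Matrix.mul_apply, Matrix.conjTranspose_apply, Matrix.smul_apply, Matrix.one_apply_eq,
      smul_eq_mul, mul_one] at this
    rw [← this]
    push_cast
    exact Finset.sum_congr rfl fun p _ => (Complex.conj_mul' (A p x)).symm
  refine ⟨(Real.sqrt (∑ p, ‖A p x‖ ^ 2) : ℝ), ?_⟩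
  rw [← hx, Complex.star_def, Complex.conj_ofReal, ← Complex.ofReal_mul,
    Real.mul_self_sqrt (Finset.sum_nonneg fun p _ => by positivity)]

theorem smul_one_matrix_injective [Nonempty h] {s t : ℂ}
    (hst : s • (1 : Matrix h h ℂ) = t • (1 : Matrix h h ℂ)) : s = t := by
  obtain ⟨x⟩ := ‹Nonempty h›
  simpa using congrFun (congrFun hst x) x

theorem sum_mul_star_eq_one_of_sq {ι : Type*} [Fintype ι] {t : ι → ℂ}
    (ht : (∑ a, t a * star (t a)) ^ 2 = 1) : ∑ a, t a * star (t a) = 1 := by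
  have h1 : ∑ a, t a * star (t a) = ((∑ a, ‖t a‖ ^ 2 : ℝ) : ℂ) := by
    push_cast
    exact Finset.sum_congr rfl fun a _ => Complex.mul_conj' (t a)
  rw [h1] at ht ⊢
  have h2 : (∑ a, ‖t a‖ ^ 2 : ℝ) ^ 2 = 1 := by exact_mod_cast ht
  have h3 : (∑ a, ‖t a‖ ^ 2 : ℝ) = 1 :=
    (pow_eq_one_iff_of_nonneg (Finset.sum_nonneg fun a _ => by positivity) two_ne_zero).1 h2
  rw [h3, Complex.ofReal_one]

theorem sum_mul_mul_star_eq_one {ι κ : Type*} [Fintype ι] [Fintype κ] {s : κ → ℂ}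
    {t : ι → ℂ} (hs : ∑ k, s k * star (s k) = 1) (ht : ∑ a, t a * star (t a) = 1) :
    ∑ i : κ × ι, s i.1 * t i.2 * star (s i.1 * t i.2) = 1 := by
  have hst : (∑ k, s k * star (s k)) * ∑ a, t a * star (t a) = 1 := by rw [hs, ht, one_mul]
  rw [← hst, Finset.sum_mul_sum, Fintype.sum_prod_type]
  simp only [star_mul']
  exact Finset.sum_congr rfl fun _ _ => Finset.sum_congr rfl fun _ _ => by ring

variable [Fintype h]
variable {ι κ : Type*} [Fintype ι] [Fintype κ]

theorem sum_snake_doubling [Nonempty h] {D : ι → Matrix (h × h) h ℂ} {e : κ → h → ℂ}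
    (hcounitL : ∀ ρ : Matrix h h ℂ, ∑ i : κ × ι,
      (effectLeft (e i.1) * D i.2) * ρ * (effectLeft (e i.1) * D i.2)ᴴ = ρ)
    (hcounitR : ∀ ρ : Matrix h h ℂ, ∑ i : κ × ι,
      (effectRight (e i.1) * D i.2) * ρ * (effectRight (e i.1) * D i.2)ᴴ = ρ)
    (hfrob : ∀ ρ : Matrix (h × h) (h × h) ℂ,
      ∑ a, ∑ b, frobCPL (D a) (D b) * ρ * (frobCPL (D a) (D b))ᴴ
        = ∑ a, ∑ b, frobCPR (D a) (D b) * ρ * (frobCPR (D a) (D b))ᴴ) (ρ : Matrix h h ℂ) :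
    ∑ i : (κ × ι) × κ × ι,
      ((frobForm (e i.1.1) (D i.1.2)).map star * frobForm (e i.2.1) (D i.2.2))ᵀ * ρ *
        ((frobForm (e i.1.1) (D i.1.2)).map star * frobForm (e i.2.1) (D i.2.2))ᵀᴴ = ρ := by
  obtain ⟨f, hf, hf1⟩ := exists_scalar_of_kraus_id hcounitL
  obtain ⟨g, hg, hg1⟩ := exists_scalar_of_kraus_id hcounitR
  have expand (F : ι → ι → Matrix (h × h) (h × h) ℂ) :
      ∑ i : (κ × ι) × κ × ι,
        (effectLeft (e i.1.1) * F i.1.2 i.2.2 * (effectRight (e i.2.1))ᴴ) * ρ *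
          (effectLeft (e i.1.1) * F i.1.2 i.2.2 * (effectRight (e i.2.1))ᴴ)ᴴ
      = ∑ l, ∑ k, effectLeft (e l) * (∑ a, ∑ b, F a b *
          ((effectRight (e k))ᴴ * ρ * effectRight (e k)) * (F a b)ᴴ) * (effectLeft (e l))ᴴ := by
    simp only [Fintype.sum_prod_type, Matrix.mul_sum, Matrix.sum_mul, Matrix.conjTranspose_mul,
      Matrix.conjTranspose_conjTranspose, Matrix.mul_assoc]
    refine Finset.sum_congr rfl fun l _ => ?_
    rw [Finset.sum_comm]
  simp only [← effect_frobCPL_effect]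
  rw [expand fun a b => frobCPL (D a) (D b)]
  simp only [hfrob]
  rw [← expand fun a b => frobCPR (D a) (D b)]
  have term (i : (κ × ι) × κ × ι) :
      effectLeft (e i.1.1) * frobCPR (D i.1.2) (D i.2.2) * (effectRight (e i.2.1))ᴴ
        = (star (g (i.2.1, i.1.2)) * f (i.1.1, i.2.2)) • (1 : Matrix h h ℂ) := by
    rw [effect_frobCPR_effect, hg (i.2.1, i.1.2), hf (i.1.1, i.2.2)]
    simp [smul_smul, mul_comm]
  simp only [term]
  rw [sum_smul_doubling _ ?_ (1 : Matrix h h ℂ) ρ]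
  · simp
  · rw [← mul_one (1 : ℂ)]
    nth_rw 1 [← hg1]
    rw [← hf1]
    simp only [Fintype.sum_prod_type, Finset.sum_mul, Finset.mul_sum, star_mul', star_star]
    refine Finset.sum_congr rfl fun l _ => ?_
    rw [Finset.sum_comm_cycle]
    refine Finset.sum_congr rfl fun b _ => ?_
    rw [Finset.sum_comm]
    exact Finset.sum_congr rfl fun _ _ => Finset.sum_congr rfl fun _ _ => by ring

/-- All the Frobenius forms built from the Kraus operators are proportional. -/
theorem exists_frobForm_eq_smul [Nonempty h] {D : ι → Matrix (h × h) h ℂ} {e : κ → h → ℂ}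
    (hcounitL : ∀ ρ : Matrix h h ℂ, ∑ i : κ × ι,
      (effectLeft (e i.1) * D i.2) * ρ * (effectLeft (e i.1) * D i.2)ᴴ = ρ)
    (hcounitR : ∀ ρ : Matrix h h ℂ, ∑ i : κ × ι,
      (effectRight (e i.1) * D i.2) * ρ * (effectRight (e i.1) * D i.2)ᴴ = ρ)
    (hfrob : ∀ ρ : Matrix (h × h) (h × h) ℂ,
      ∑ a, ∑ b, frobCPL (D a) (D b) * ρ * (frobCPL (D a) (D b))ᴴ
        = ∑ a, ∑ b, frobCPR (D a) (D b) * ρ * (frobCPR (D a) (D b))ᴴ) :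
    ∃ (u : h × h → ℂ) (r : ι → κ → ℂ), ∀ a k, D a *ᵥ star (e k) = r a k • u := by
  obtain ⟨s, hs, hs1⟩ := exists_scalar_of_kraus_id (sum_snake_doubling hcounitL hcounitR hfrob)
  obtain ⟨i, -, hi⟩ := Finset.exists_ne_zero_of_sum_ne_zero (hs1.trans_ne one_ne_zero)
  have hi : s i ≠ 0 := left_ne_zero_of_mul hi
  have hs' (j) := (congrArg Matrix.transpose (hs j)).trans
    (by rw [Matrix.transpose_smul, Matrix.transpose_one] :
      (s j • (1 : Matrix h h ℂ))ᵀ = s j • (1 : Matrix h h ℂ))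
  simp only [Matrix.transpose_transpose] at hs'
  set V := (frobForm (e i.1.1) (D i.1.2)).map star with hV
  set U := frobForm (e i.2.1) (D i.2.2) with hU
  have hUV : ((s i)⁻¹ • U) * V = 1 := by
    rw [mul_eq_one_comm, Matrix.mul_smul, hs' i, smul_smul, inv_mul_cancel₀ hi, one_smul]
  refine ⟨fun p => U p.1 p.2, fun a k => s (i.1, (k, a)) * (s i)⁻¹, fun a k => ?_⟩
  have : frobForm (e k) (D a) = (s (i.1, (k, a)) * (s i)⁻¹) • U := by
    rw [← Matrix.one_mul (frobForm (e k) (D a)), ← hUV, Matrix.mul_assoc, hs' (i.1, (k, a)),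
      Matrix.mul_smul, Matrix.mul_one, smul_smul]
  ext p
  exact congrFun (congrFun this p.1) p.2

open scoped ComplexOrder in
theorem exists_purification [Nonempty h] {D : ι → Matrix (h × h) h ℂ} {e : κ → h → ℂ}
    (hcounitL : ∀ ρ : Matrix h h ℂ, ∑ i : κ × ι,
      (effectLeft (e i.1) * D i.2) * ρ * (effectLeft (e i.1) * D i.2)ᴴ = ρ)
    (hcounitR : ∀ ρ : Matrix h h ℂ, ∑ i : κ × ι,
      (effectRight (e i.1) * D i.2) * ρ * (effectRight (e i.1) * D i.2)ᴴ = ρ)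
    (hspecial : ∀ ρ : Matrix h h ℂ, ∑ i : ι × ι,
      ((D i.1)ᴴ * D i.2) * ρ * ((D i.1)ᴴ * D i.2)ᴴ = ρ)
    (hfrob : ∀ ρ : Matrix (h × h) (h × h) ℂ,
      ∑ a, ∑ b, frobCPL (D a) (D b) * ρ * (frobCPL (D a) (D b))ᴴ
        = ∑ a, ∑ b, frobCPR (D a) (D b) * ρ * (frobCPR (D a) (D b))ᴴ) :
    ∃ (δ : Matrix (h × h) h ℂ) (ε : h → ℂ) (t : ι → ℂ) (s : κ → ℂ),
      (∀ a, D a = t a • δ) ∧ (∀ k, e k = s k • ε) ∧ δᴴ * δ = 1 ∧ effectLeft ε * δ = 1 ∧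
      ∑ a, t a * star (t a) = 1 ∧ ∑ k, s k * star (s k) = 1 := by
  obtain ⟨f, hf, hf1⟩ := exists_scalar_of_kraus_id hcounitL
  obtain ⟨c, hc, hc1⟩ := exists_scalar_of_kraus_id hspecial
  obtain ⟨u, r, hr⟩ := exists_frobForm_eq_smul hcounitL hcounitR hfrob
  obtain ⟨⟨k₀, a₀⟩, -, h₀⟩ := Finset.exists_ne_zero_of_sum_ne_zero (hf1.trans_ne one_ne_zero)
  have hf₀ : f (k₀, a₀) ≠ 0 := left_ne_zero_of_mul h₀
  have hprod : effectLeft (e k₀) * D a₀ ≠ 0 := by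
    rw [hf (k₀, a₀)]
    exact smul_ne_zero hf₀ one_ne_zero
  have hD₀ : D a₀ ≠ 0 := fun h0 => hprod (by rw [h0, Matrix.mul_zero])
  set w := star (e k₀) with hw
  have hw0 : w ≠ 0 := fun h0 => hprod (by
    rw [star_eq_zero.1 h0]
    ext
    simp [effectLeft_mul_apply])
  have hc₀ : c (a₀, a₀) ≠ 0 := fun h0 => hD₀ (by
    rw [← Matrix.conjTranspose_mul_self_eq_zero, hc (a₀, a₀), h0, zero_smul])
  have hGram (v : h → ℂ) : (D a₀)ᴴ *ᵥ (D a₀ *ᵥ v) = c (a₀, a₀) • v := by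
    rw [Matrix.mulVec_mulVec, hc (a₀, a₀), Matrix.smul_mulVec, Matrix.one_mulVec]
  have hinj {v v' : h → ℂ} (hv : D a₀ *ᵥ v = D a₀ *ᵥ v') : v = v' := by
    have := congrArg ((D a₀)ᴴ *ᵥ ·) hv
    simp only [hGram] at this
    exact smul_right_injective _ hc₀ this
  have hr₀ : r a₀ k₀ ≠ 0 := fun h0 => hw0 (hinj (by
    rw [hr a₀ k₀, h0, zero_smul, Matrix.mulVec_zero]))
  have hu : u = (r a₀ k₀)⁻¹ • (D a₀ *ᵥ w) := by
    rw [hr a₀ k₀, smul_smul, inv_mul_cancel₀ hr₀, one_smul]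
  have hD (b : ι) : D b = (r b k₀ * (r a₀ k₀)⁻¹) • D a₀ := by
    set τ := r b k₀ * (r a₀ k₀)⁻¹ with hτ
    have hX : (D b - τ • D a₀)ᴴ * (D b - τ • D a₀)
        = (c (b, b) - τ * c (b, a₀) - star τ * c (a₀, b) + star τ * τ * c (a₀, a₀))
          • (1 : Matrix h h ℂ) := by
      simp only [Matrix.conjTranspose_sub, Matrix.conjTranspose_smul, Matrix.sub_mul,
        Matrix.mul_sub, Matrix.smul_mul, Matrix.mul_smul, hc (b, b), hc (b, a₀), hc (a₀, b),
        hc (a₀, a₀)]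
      module
    have hXw : (D b - τ • D a₀) *ᵥ w = 0 := by
      rw [Matrix.sub_mulVec, Matrix.smul_mulVec, hr b k₀, hu, smul_smul, sub_self]
    have hx := congrArg ((D b - τ • D a₀)ᴴ *ᵥ ·) hXw
    simp only [Matrix.mulVec_mulVec, hX, Matrix.mulVec_zero, Matrix.smul_mulVec,
      Matrix.one_mulVec] at hx
    rw [(smul_eq_zero.1 hx).resolve_right hw0, zero_smul,
      Matrix.conjTranspose_mul_self_eq_zero] at hX
    exact sub_eq_zero.1 hX
  have he (k : κ) : e k = star (r a₀ k * (r a₀ k₀)⁻¹) • e k₀ := by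
    apply star_injective
    rw [star_smul, star_star]
    apply hinj
    rw [Matrix.mulVec_smul, hr a₀ k, hu, smul_smul]
  obtain ⟨κ₀, hκ⟩ := exists_star_mul_self_of_isometry_smul (hc (a₀, a₀))
  have hκ0 : κ₀ ≠ 0 := fun h0 => hc₀ (by rw [← hκ, h0, mul_zero])
  have hκ0' : star κ₀ ≠ 0 := star_ne_zero.2 hκ0
  set δ := κ₀⁻¹ • D a₀ with hδ
  have hδδ : δᴴ * δ = 1 := by
    rw [hδ, Matrix.conjTranspose_smul, Matrix.smul_mul, Matrix.mul_smul, hc (a₀, a₀), ← hκ,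
      smul_smul, smul_smul, star_inv₀]
    rw [show (star κ₀)⁻¹ * κ₀⁻¹ * (star κ₀ * κ₀) = 1 by field_simp, one_smul]
  set t : ι → ℂ := fun b => r b k₀ * (r a₀ k₀)⁻¹ * κ₀ with ht
  have hDt (b : ι) : D b = t b • δ := by
    rw [hD b, hδ, smul_smul, ht]
    simp only [mul_assoc, mul_inv_cancel₀ hκ0, mul_one]
  have hct (a b : ι) : c (a, b) = star (t a) * t b := by
    apply smul_one_matrix_injective (h := h)
    rw [← hc (a, b), hDt a, hDt b, Matrix.conjTranspose_smul, Matrix.smul_mul, Matrix.mul_smul,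
      hδδ, smul_smul]
  have ht1 : ∑ a, t a * star (t a) = 1 := by
    apply sum_mul_star_eq_one_of_sq
    rw [← hc1, Fintype.sum_prod_type, sq, Finset.sum_mul_sum]
    simp only [hct, star_mul', star_star]
    exact Finset.sum_congr rfl fun _ _ => Finset.sum_congr rfl fun _ _ => by ring
  set φ := κ₀⁻¹ * f (k₀, a₀) with hφ
  have hφ0 : φ ≠ 0 := mul_ne_zero (inv_ne_zero hκ0) hf₀
  set ε := φ⁻¹ • e k₀ with hε
  have hεδ : effectLeft ε * δ = 1 := by
    rw [hε, hδ, effectLeft_smul, Matrix.smul_mul, Matrix.mul_smul, hf (k₀, a₀), smul_smul,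
      smul_smul, mul_assoc, ← hφ, inv_mul_cancel₀ hφ0, one_smul]
  set s : κ → ℂ := fun k => star (r a₀ k * (r a₀ k₀)⁻¹) * φ with hs
  have hes (k : κ) : e k = s k • ε := by
    rw [he k, hε, smul_smul, hs]
    simp only [mul_assoc, mul_inv_cancel₀ hφ0, mul_one]
  have hfs (k : κ) (a : ι) : f (k, a) = s k * t a := by
    apply smul_one_matrix_injective (h := h)
    rw [← hf (k, a)]
    simp only
    rw [hDt a, hes k, effectLeft_smul, Matrix.smul_mul, Matrix.mul_smul, hεδ, smul_smul]
  refine ⟨δ, ε, t, s, hDt, hes, hδδ, hεδ, ht1, ?_⟩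
  rw [← mul_one (∑ k, s k * star (s k)), ← ht1, Finset.sum_mul_sum, ht1, ← hf1,
    Fintype.sum_prod_type]
  simp only [hfs, star_mul']
  exact Finset.sum_congr rfl fun _ _ => Finset.sum_congr rfl fun _ _ => by ring

end Purification

section Phases

variable {h : Type*} [Fintype h] [DecidableEq h] {δ : Matrix (h × h) h ℂ} {ε : h → ℂ}

theorem sum_effect_left (hL : effectLeft ε * δ = 1) (x y : h) :
    ∑ c, ε c * δ (c, x) y = if x = y then 1 else 0 := by
  rw [← effectLeft_mul_apply, hL, Matrix.one_apply]

theorem sum_effect_right {g : ℂ} (hR : effectRight ε * δ = g • (1 : Matrix h h ℂ)) (x y : h) :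
    ∑ c, ε c * δ (x, c) y = if x = y then g else 0 := by
  rw [← effectRight_mul_apply, hR, Matrix.smul_apply, Matrix.one_apply, smul_eq_mul, mul_ite,
    mul_one, mul_zero]

theorem sum_effect_coassocL_left (hL : effectLeft ε * δ = 1) (y z w : h) :
    ∑ x, ε x * coassocL δ δ ((x, y), z) w = δ (y, z) w := by
  simp only [coassocL_apply, Finset.mul_sum]
  rw [Finset.sum_comm]
  simp only [← mul_assoc, ← Finset.sum_mul, sum_effect_left hL]
  simp

theorem sum_effect_coassocR_left (hL : effectLeft ε * δ = 1) (y z w : h) :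
    ∑ x, ε x * coassocR δ δ ((x, y), z) w = δ (y, z) w := by
  simp only [coassocR_apply, Finset.mul_sum]
  rw [Finset.sum_comm]
  simp only [mul_left_comm (ε _), ← Finset.mul_sum, sum_effect_left hL]
  simp

theorem sum_effect_coassocL_middle {g : ℂ} (hR : effectRight ε * δ = g • (1 : Matrix h h ℂ))
    (x z w : h) : ∑ y, ε y * coassocL δ δ ((x, y), z) w = g * δ (x, z) w := by
  simp only [coassocL_apply, Finset.mul_sum]
  rw [Finset.sum_comm]
  simp only [← mul_assoc, ← Finset.sum_mul, sum_effect_right hR]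
  simp

theorem sum_effect_coassocR_middle (hL : effectLeft ε * δ = 1) (x z w : h) :
    ∑ y, ε y * coassocR δ δ ((x, y), z) w = δ (x, z) w := by
  simp only [coassocR_apply, Finset.mul_sum]
  rw [Finset.sum_comm]
  simp only [← mul_assoc, ← Finset.sum_mul, sum_effect_left hL]
  simp

theorem exists_apply_ne_zero_of_isometry [Nonempty h] (hδ : δᴴ * δ = 1) :
    ∃ x y z, δ (x, y) z ≠ 0 := by
  by_contra! h0
  have : δ = 0 := by ext ⟨x, y⟩ z; exact h0 x y z
  rw [this, Matrix.mul_zero] at hδ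
  exact zero_ne_one hδ

theorem coassoc_of_phase [Nonempty h] (hδ : δᴴ * δ = 1) (hL : effectLeft ε * δ = 1) {ω : ℂ}
    (hω : coassocL δ δ = ω • coassocR δ δ) : coassocL δ δ = coassocR δ δ := by
  obtain ⟨y, z, w, h0⟩ := exists_apply_ne_zero_of_isometry hδ
  have : δ (y, z) w = ω * δ (y, z) w := by
    nth_rw 1 [← sum_effect_coassocL_left hL y z w]
    simp only [hω, Matrix.smul_apply, smul_eq_mul, mul_left_comm (ε _), ← Finset.mul_sum,
      sum_effect_coassocR_left hL]
  have hω1 : ω = 1 := (mul_left_eq_self₀.1 this.symm).resolve_right h0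
  rw [hω, hω1, one_smul]

theorem effectRight_mul_of_coassoc [Nonempty h] (hδ : δᴴ * δ = 1) (hL : effectLeft ε * δ = 1)
    {g : ℂ} (hR : effectRight ε * δ = g • (1 : Matrix h h ℂ))
    (hco : coassocL δ δ = coassocR δ δ) : effectRight ε * δ = 1 := by
  obtain ⟨x, z, w, h0⟩ := exists_apply_ne_zero_of_isometry hδ
  have : g * δ (x, z) w = δ (x, z) w := by
    rw [← sum_effect_coassocL_middle hR, hco, sum_effect_coassocR_middle hL]
  rw [hR, (mul_left_eq_self₀.1 this).resolve_right h0, one_smul]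

theorem conjTranspose_coassocL_mul_self (hδ : δᴴ * δ = 1) :
    (coassocL δ δ)ᴴ * coassocL δ δ = 1 := by
  rw [coassocL, Matrix.conjTranspose_mul, Matrix.mul_assoc, ← Matrix.mul_assoc (δ ⊗ₖ 1)ᴴ,
    Matrix.conjTranspose_kronecker, ← Matrix.mul_kronecker_mul, hδ]
  simp [hδ]

theorem conjTranspose_mul_frobCPL_mul :
    δᴴ * frobCPL δ δ * δ = (coassocL δ δ)ᴴ * coassocR δ δ := by
  rw [frobCPL, coassocL, coassocR, Matrix.conjTranspose_mul, Matrix.conjTranspose_kronecker,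
    Matrix.conjTranspose_one]
  simp only [Matrix.mul_assoc]
  congr 2

theorem conjTranspose_mul_frobCPR_mul :
    δᴴ * frobCPR δ δ * δ = (coassocR δ δ)ᴴ * coassocL δ δ := by
  have : frobCPR δ δ * δ = ((1 : Matrix h h ℂ) ⊗ₖ δᴴ) *
      Matrix.reindex (Equiv.prodAssoc h h h) (Equiv.refl h) (coassocL δ δ) := by
    rw [frobCPR, Matrix.mul_assoc]
    congr 1
  rw [Matrix.mul_assoc, this, coassocR, ← Matrix.mul_assoc, ← Matrix.conjTranspose_one,
    ← Matrix.conjTranspose_kronecker, ← Matrix.conjTranspose_mul]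
  simp only [Matrix.reindex_apply, Matrix.conjTranspose_submatrix, Matrix.conjTranspose_one]
  ext a b
  simp only [Matrix.mul_apply, Matrix.submatrix_apply]
  exact Fintype.sum_equiv (Equiv.prodAssoc h h h).symm _ _ fun p => by simp

theorem frob_of_phase [Nonempty h] (hδ : δᴴ * δ = 1) (hco : coassocL δ δ = coassocR δ δ) {ω : ℂ}
    (hω : frobCPL δ δ = ω • frobCPR δ δ) : frobCPL δ δ = frobCPR δ δ := by
  have h1 : (1 : ℂ) • (1 : Matrix h h ℂ) = ω • (1 : Matrix h h ℂ) := by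
    rw [one_smul, ← conjTranspose_coassocL_mul_self hδ]
    nth_rw 2 [hco]
    rw [← conjTranspose_mul_frobCPL_mul, hω, Matrix.mul_smul, Matrix.smul_mul,
      conjTranspose_mul_frobCPR_mul, ← hco]
  rw [hω, ← smul_one_matrix_injective h1, one_smul]

theorem effect_mulVec_star (E : Matrix h (h × h) ℂ) (hE : E * δ = 1) :
    E *ᵥ (δ *ᵥ star ε) = star ε := by
  rw [Matrix.mulVec_mulVec, hE, Matrix.one_mulVec]

theorem effectLeft_mulVec_swap (u : h × h → ℂ) :
    effectLeft ε *ᵥ (fun p => u (p.2, p.1)) = effectRight ε *ᵥ u := by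
  ext x
  simp only [Matrix.mulVec, dotProduct, effectLeft, effectRight, Matrix.of_apply]
  exact Fintype.sum_equiv (Equiv.prodComm h h) _ _ fun _ => rfl

theorem symm_of_phase [Nonempty h] (hL : effectLeft ε * δ = 1) (hR : effectRight ε * δ = 1) {ω : ℂ}
    (hω : ∀ p : h × h, (δ *ᵥ star ε) (p.2, p.1) = ω * (δ *ᵥ star ε) p) :
    (fun p : h × h => (δ *ᵥ star ε) (p.2, p.1)) = δ *ᵥ star ε := by
  have hω' : (fun p : h × h => (δ *ᵥ star ε) (p.2, p.1)) = ω • (δ *ᵥ star ε) := funext hω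
  have hε : star ε ≠ 0 := fun h0 => by
    have : effectLeft ε = 0 := by
      rw [star_eq_zero.1 h0]
      ext
      simp [effectLeft]
    rw [this, Matrix.zero_mul] at hL
    exact zero_ne_one hL
  have h1 : (1 : ℂ) • star ε = ω • star ε := by
    have h2 := effectLeft_mulVec_swap (ε := ε) (δ *ᵥ star ε)
    rw [hω', Matrix.mulVec_smul, effect_mulVec_star _ hL, effect_mulVec_star _ hR] at h2
    rw [one_smul, h2]
  rw [hω', ← smul_left_injective ℂ hε h1, one_smul]

end Phases

/-- All dagger special symmetric Frobenius algebras in `CPM(fHilb)` are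
canonical: if CP maps `Δ : L(H) → L(H ⊗ H)` and `E : L(H) → ℂ` (given by Kraus
decompositions) satisfy coassociativity, the counit laws, symmetry, specialness
(`Δ† ∘ Δ = id`) and the Frobenius law as CP maps, then they arise by doubling
(`Δ = δ (·) δ†`, `E = ε (·) ε†`) of linear maps `δ : H → H ⊗ H`, `ε : H → ℂ`
forming a dagger special symmetric Frobenius algebra in `fHilb`. -/
theorem stmt16 {h : Type*} [Fintype h] [DecidableEq h]
    (Δ : Matrix h h ℂ → Matrix (h × h) (h × h) ℂ)
    (E : Matrix h h ℂ → ℂ)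
    (m n : ℕ) (D : Fin m → Matrix (h × h) h ℂ) (e : Fin n → h → ℂ)
    (hΔ : ∀ ρ, Δ ρ = ∑ a, D a * ρ * (D a)ᴴ)
    (hE : ∀ ρ, E ρ = ∑ kk, ∑ x, ∑ y, e kk x * ρ x y * star (e kk y))
    (hcoassoc : ∀ ρ : Matrix h h ℂ,
      ∑ a, ∑ b, coassocL (D a) (D b) * ρ * (coassocL (D a) (D b))ᴴ
        = ∑ a, ∑ b, coassocR (D a) (D b) * ρ * (coassocR (D a) (D b))ᴴ)
    (hcounitL : ∀ ρ : Matrix h h ℂ,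
      (Matrix.of fun x y => ∑ kk, ∑ a, ∑ c, ∑ d,
        e kk c * (D a * ρ * (D a)ᴴ) (c, x) (d, y) * star (e kk d)) = ρ)
    (hcounitR : ∀ ρ : Matrix h h ℂ,
      (Matrix.of fun x y => ∑ kk, ∑ a, ∑ c, ∑ d,
        e kk c * (D a * ρ * (D a)ᴴ) (x, c) (y, d) * star (e kk d)) = ρ)
    (hsymm : Matrix.reindex (Equiv.prodComm h h) (Equiv.prodComm h h)
        (Δ (∑ kk, Matrix.of fun c d => star (e kk c) * e kk d))
      = Δ (∑ kk, Matrix.of fun c d => star (e kk c) * e kk d))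
    (hspecial : ∀ ρ : Matrix h h ℂ,
      ∑ a, ∑ b, (D a)ᴴ * (D b * ρ * (D b)ᴴ) * D a = ρ)
    (hfrob : ∀ ρ : Matrix (h × h) (h × h) ℂ,
      ∑ a, ∑ b, frobCPL (D a) (D b) * ρ * (frobCPL (D a) (D b))ᴴ
        = ∑ a, ∑ b, frobCPR (D a) (D b) * ρ * (frobCPR (D a) (D b))ᴴ) :
    ∃ (δ : Matrix (h × h) h ℂ) (ε : h → ℂ),
      (∀ ρ, Δ ρ = δ * ρ * δᴴ) ∧
      (∀ ρ, E ρ = ∑ x, ∑ y, ε x * ρ x y * star (ε y)) ∧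
      -- coassociativity in fHilb
      coassocL δ δ = coassocR δ δ ∧
      -- unit laws in fHilb
      (Matrix.of fun x y => ∑ c, ε c * δ (c, x) y) = (1 : Matrix h h ℂ) ∧
      (Matrix.of fun x y => ∑ c, ε c * δ (x, c) y) = (1 : Matrix h h ℂ) ∧
      -- symmetry in fHilb
      (fun p : h × h => (δ *ᵥ fun x => star (ε x)) (p.2, p.1))
        = (δ *ᵥ fun x => star (ε x)) ∧
      -- specialness in fHilb
      δᴴ * δ = 1 ∧
      -- Frobenius law in fHilb
      frobCPL δ δ = frobCPR δ δ := by
  rcases isEmpty_or_nonempty h with hempty | hne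
  · refine ⟨0, 0, fun ρ => ?_, fun ρ => ?_, ?_, ?_, ?_, ?_, ?_, ?_⟩
    · exact Subsingleton.elim _ _
    · simp [hE]
    all_goals exact Subsingleton.elim _ _
  have hcL (ρ : Matrix h h ℂ) : ∑ i : Fin n × Fin m,
      (effectLeft (e i.1) * D i.2) * ρ * (effectLeft (e i.1) * D i.2)ᴴ = ρ := by
    refine Eq.trans ?_ (hcounitL ρ)
    ext x y
    simp only [Matrix.conjTranspose_mul, Fintype.sum_prod_type, Matrix.sum_apply, Matrix.of_apply]
    exact Finset.sum_congr rfl fun k _ => Finset.sum_congr rfl fun a _ => by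
      rw [← effectLeft_doubling_apply]
      simp only [Matrix.mul_assoc]
  have hcR (ρ : Matrix h h ℂ) : ∑ i : Fin n × Fin m,
      (effectRight (e i.1) * D i.2) * ρ * (effectRight (e i.1) * D i.2)ᴴ = ρ := by
    refine Eq.trans ?_ (hcounitR ρ)
    ext x y
    simp only [Matrix.conjTranspose_mul, Fintype.sum_prod_type, Matrix.sum_apply, Matrix.of_apply]
    exact Finset.sum_congr rfl fun k _ => Finset.sum_congr rfl fun a _ => by
      rw [← effectRight_doubling_apply]
      simp only [Matrix.mul_assoc]
  have hsp (ρ : Matrix h h ℂ) : ∑ i : Fin m × Fin m,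
      ((D i.1)ᴴ * D i.2) * ρ * ((D i.1)ᴴ * D i.2)ᴴ = ρ := by
    refine Eq.trans ?_ (hspecial ρ)
    simp only [Fintype.sum_prod_type, Matrix.conjTranspose_mul, Matrix.conjTranspose_conjTranspose,
      Matrix.mul_assoc]
  obtain ⟨δ, ε, t, s, hD, he, hδ, hL, ht, hs⟩ := exists_purification hcL hcR hsp hfrob
  have ht2 := sum_mul_mul_star_eq_one ht ht
  have ht2' : ∑ i : Fin m × Fin m, star (t i.1) * t i.2 * star (star (t i.1) * t i.2) = 1 := by
    rw [← ht2]
    simp only [star_mul', star_star]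
    exact Finset.sum_congr rfl fun _ _ => by ring
  have hst := sum_mul_mul_star_eq_one hs ht
  have hΔδ (ρ : Matrix h h ℂ) : Δ ρ = δ * ρ * δᴴ := by
    rw [hΔ]
    simp only [hD]
    exact sum_smul_doubling t ht δ ρ
  have hco : coassocL δ δ = coassocR δ δ := by
    obtain ⟨ω, hω⟩ := exists_phase_of_doubling_eq (A := coassocL δ δ) (B := coassocR δ δ)
      fun ρ => by
        have := hcoassoc ρ
        simp only [hD, coassocL_smul, coassocR_smul, ← Fintype.sum_prod_type'] at this
        rwa [sum_smul_doubling _ ht2, sum_smul_doubling _ ht2] at this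
    exact coassoc_of_phase hδ hL hω
  have hR : effectRight ε * δ = 1 := by
    obtain ⟨g, hg, -⟩ := exists_scalar_of_kraus_id (ι := Unit) (K := fun _ => effectRight ε * δ)
      fun ρ => by
        have hterm (i : Fin n × Fin m) :
            effectRight (e i.1) * D i.2 = (s i.1 * t i.2) • (effectRight ε * δ) := by
          rw [hD, he, effectRight_smul, Matrix.smul_mul, Matrix.mul_smul, smul_smul]
        have := hcR ρ
        simp only [hterm] at this
        rw [sum_smul_doubling _ hst] at this
        simpa using this
    exact effectRight_mul_of_coassoc hδ hL (hg ()) hco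
  have hfr : frobCPL δ δ = frobCPR δ δ := by
    obtain ⟨ω, hω⟩ := exists_phase_of_doubling_eq (A := frobCPL δ δ) (B := frobCPR δ δ)
      fun ρ => by
        have := hfrob ρ
        simp only [hD, frobCPL_smul, frobCPR_smul, ← Fintype.sum_prod_type'] at this
        rwa [sum_smul_doubling _ ht2', sum_smul_doubling _ ht2'] at this
    exact frob_of_phase hδ hco hω
  have hunit : ∑ k, Matrix.of (fun c d => star (e k c) * e k d) = Matrix.vecMulVec (star ε) ε := by
    ext c d
    simp only [Matrix.sum_apply, Matrix.of_apply, he, Pi.smul_apply, smul_eq_mul, star_mul',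
      Matrix.vecMulVec_apply, Pi.star_apply]
    rw [← one_mul (star (ε c) * ε d), ← hs, Finset.sum_mul]
    exact Finset.sum_congr rfl fun _ _ => by ring
  have hsy : (fun p : h × h => (δ *ᵥ star ε) (p.2, p.1)) = δ *ᵥ star ε := by
    have hcup : Δ (∑ k, Matrix.of fun c d => star (e k c) * e k d)
        = Matrix.vecMulVec (δ *ᵥ star ε) (star (δ *ᵥ star ε)) := by
      rw [hunit, hΔδ, Matrix.mul_vecMulVec, Matrix.vecMulVec_mul, Matrix.star_mulVec, star_star]
    obtain ⟨ω, hω⟩ := exists_phase (f := fun p : h × h => (δ *ᵥ star ε) (p.2, p.1))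
      (g := δ *ᵥ star ε) fun p q => by
        have := congrFun (congrFun hsymm p) q
        rw [hcup] at this
        exact this
    exact symm_of_phase hL hR hω
  refine ⟨δ, ε, hΔδ, fun ρ => ?_, hco, ?_, ?_, hsy, hδ, hfr⟩
  · rw [hE]
    simp only [he, Pi.smul_apply, smul_eq_mul, star_mul']
    refine Eq.trans ?_ (one_mul _)
    rw [← hs, Finset.sum_mul]
    simp only [Finset.mul_sum]
    exact Finset.sum_congr rfl fun _ _ => Finset.sum_congr rfl fun _ _ =>
      Finset.sum_congr rfl fun _ _ => by ring
  · rw [← hL]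
    ext x y
    rw [effectLeft_mul_apply, Matrix.of_apply]
  · rw [← hR]
    ext x y
    rw [effectRight_mul_apply, Matrix.of_apply]
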